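/- arXiv:2505.18447 — 6 statements merged into one kernel-verified Lean document; each statement's English description precedes it below -/
import Mathlib

section
/- (Pessimism of the averaged-operator proxy.) Suppose P_0 is a transition kernel with (P_0)_s^a ∈ (𝒫_k)_s^a for every k ∈ {1,…,K} and every (s,a) ∈ S × A. Then for every policy π and every state s, V_AO^π(s) ≤ V_{P_0}^π(s). -/
noncomputable section

/-- The probability simplex on a finite set `S`. -/
def simplex (S : Type*) [Fintype S] : Set (S → ℝ) :=
  {p | (∀ s, 0 ≤ p s) ∧ ∑ s, p s = 1}

/-- Support function of a set of distributions: `σ_C(v) = inf_{p ∈ C} ∑_s p s * v s`. -/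
def suppFn {S : Type*} [Fintype S] (C : Set (S → ℝ)) (v : S → ℝ) : ℝ :=
  sInf ((fun p => ∑ s, p s * v s) '' C)

/-- Robust Bellman operator of a policy `π`:
`(T_𝒫^π Q)(s,a) = r(s,a) + γ σ_{𝒫_s^a}(V_Q^π)` with `V_Q^π(s) = ∑_a π(a|s) Q(s,a)`. -/
def robustOp {S A : Type*} [Fintype S] [Fintype A] (r : S × A → ℝ) (γ : ℝ)
    (P : S → A → Set (S → ℝ)) (π : S → A → ℝ) (Q : S × A → ℝ) : S × A → ℝ :=
  fun sa => r sa + γ * suppFn (P sa.1 sa.2) (fun s' => ∑ a', π s' a' * Q (s', a'))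

/-- Optimal robust Bellman operator:
`(T_𝒫 Q)(s,a) = r(s,a) + γ σ_{𝒫_s^a}(s' ↦ max_{a'} Q(s',a'))`. -/
def optRobustOp {S A : Type*} [Fintype S] [Fintype A] [Nonempty A] (r : S × A → ℝ) (γ : ℝ)
    (P : S → A → Set (S → ℝ)) (Q : S × A → ℝ) : S × A → ℝ :=
  fun sa => r sa + γ * suppFn (P sa.1 sa.2)
    (fun s' => Finset.univ.sup' Finset.univ_nonempty (fun a' => Q (s', a')))

/-- A weighted average of values bounded by `c` is bounded by `c`. -/
lemma sum_mul_le_of_mem_simplex {S : Type*} [Fintype S] {p v : S → ℝ} {c : ℝ}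
    (hp : p ∈ simplex S) (hv : ∀ s, v s ≤ c) : ∑ s, p s * v s ≤ c :=
  calc ∑ s, p s * v s ≤ ∑ s, p s * c :=
        Finset.sum_le_sum fun s _ => mul_le_mul_of_nonneg_left (hv s) (hp.1 s)
    _ = c := by rw [← Finset.sum_mul, hp.2, one_mul]

lemma suppFn_singleton {S : Type*} [Fintype S] (p v : S → ℝ) :
    suppFn {p} v = ∑ s, p s * v s := by
  simp [suppFn]

/-- The support function of a compact set is at most the expectation under any of its members. -/
lemma suppFn_le_of_mem {S : Type*} [Fintype S] {C : Set (S → ℝ)} (hC : IsCompact C)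
    {p : S → ℝ} (hp : p ∈ C) (v : S → ℝ) : suppFn C v ≤ ∑ s, p s * v s :=
  csInf_le (hC.image (by fun_prop)).bddBelow (Set.mem_image_of_mem _ hp)

/-- **Pessimism of the averaged-operator proxy.**  If the target kernel `P0`
belongs to every source uncertainty set, then the averaged-operator proxy
`V_AO^π` lower-bounds the target value function `V_{P0}^π`. -/
theorem averaged_proxy_pessimism {S A : Type*} [Fintype S] [Fintype A]
    [Nonempty S] [Nonempty A]
    (r : S × A → ℝ) (hr : ∀ sa, 0 ≤ r sa ∧ r sa ≤ 1)
    (γ : ℝ) (hγ0 : 0 ≤ γ) (hγ1 : γ < 1)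
    (K : ℕ) [NeZero K]
    (P : Fin K → S → A → Set (S → ℝ))
    (hP : ∀ k s a, (P k s a).Nonempty ∧ IsCompact (P k s a) ∧ P k s a ⊆ simplex S)
    (P0 : S → A → (S → ℝ)) (hP0 : ∀ k s a, P0 s a ∈ P k s a)
    (π : S → A → ℝ) (hπ : ∀ s, π s ∈ simplex A)
    (QAO : S × A → ℝ)
    (hQAO : (fun sa => (K : ℝ)⁻¹ * ∑ k, robustOp r γ (P k) π QAO sa) = QAO)
    (QP0 : S × A → ℝ)
    (hQP0 : robustOp r γ (fun s a => {P0 s a}) π QP0 = QP0) :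
    ∀ s, ∑ a, π s a * QAO (s, a) ≤ ∑ a, π s a * QP0 (s, a) := by
  have hle : ∀ s a, QAO (s, a) ≤
      r (s, a) + γ * ∑ s', P0 s a s' * ∑ a', π s' a' * QAO (s', a') := by
    intro s a
    have hK : (0 : ℝ) < K := Nat.cast_pos.mpr (NeZero.pos K)
    calc QAO (s, a) = (K : ℝ)⁻¹ * ∑ k, robustOp r γ (P k) π QAO (s, a) :=
          (congrFun hQAO (s, a)).symm
      _ ≤ (K : ℝ)⁻¹ * ∑ _k : Fin K,
          (r (s, a) + γ * ∑ s', P0 s a s' * ∑ a', π s' a' * QAO (s', a')) := by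
        refine mul_le_mul_of_nonneg_left (Finset.sum_le_sum fun k _ => ?_) (inv_nonneg.mpr hK.le)
        exact add_le_add_right (mul_le_mul_of_nonneg_left
          (suppFn_le_of_mem (hP k s a).2.1 (hP0 k s a) _) hγ0) _
      _ = _ := by
        rw [Finset.sum_const, Finset.card_univ, Fintype.card_fin, nsmul_eq_mul,
          inv_mul_cancel_left₀ hK.ne']
  have heq : ∀ s a, QP0 (s, a) =
      r (s, a) + γ * ∑ s', P0 s a s' * ∑ a', π s' a' * QP0 (s', a') := by
    intro s a
    have h := congrFun hQP0 (s, a)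
    simp only [robustOp, suppFn_singleton] at h
    exact h.symm
  have hgap : ∀ s, ∑ a, π s a * (QAO (s, a) - QP0 (s, a)) =
      ∑ a, π s a * QAO (s, a) - ∑ a, π s a * QP0 (s, a) := by
    intro s
    simp only [mul_sub, Finset.sum_sub_distrib]
  obtain ⟨m, hm⟩ := Finite.exists_max fun s => ∑ a, π s a * (QAO (s, a) - QP0 (s, a))
  set M := ∑ a, π m a * (QAO (m, a) - QP0 (m, a)) with hM
  have hcontr : M ≤ γ * M := by
    refine sum_mul_le_of_mem_simplex (hπ m) fun a => ?_
    have hP0m : P0 m a ∈ simplex S := (hP 0 m a).2.2 (hP0 0 m a)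
    have hexp := mul_le_mul_of_nonneg_left (sum_mul_le_of_mem_simplex hP0m hm) hγ0
    simp only [mul_sub, Finset.sum_sub_distrib] at hexp
    linarith [hle m a, heq m a]
  have hM0 : M ≤ 0 := by nlinarith
  intro s
  linarith [hm s, hgap s]
end
end

section
/- Let P_1, …, P_K be transition kernels, P̄ = (1/K) Σ_{k=1}^K P_k their average, and for radii Γ_s^a ≥ 0 define the total-variation uncertainty sets (𝒫_k)_s^a = { q ∈ Δ(S) : (1/2)‖q − (P_k)_s^a‖₁ ≤ Γ_s^a } and 𝒫̄_s^a = { q ∈ Δ(S) : (1/2)‖q − P̄_s^a‖₁ ≤ Γ_s^a }. Then for every policy π and every state s, V_𝒫̄^π(s) ≤ V_AO^π(s), where V_𝒫̄^π is the robust value function of the uncertainty set 𝒫̄ and V_AO^π comes from the averaged-operator fixed point over the sets (𝒫_k). -/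
noncomputable section

/-- Total-variation ball of radius `Γ` around `p` inside the simplex. -/
def tvBall {S : Type*} [Fintype S] (p : S → ℝ) (Γ : ℝ) : Set (S → ℝ) :=
  {q ∈ simplex S | (1 / 2) * ∑ s, |q s - p s| ≤ Γ}

theorem bddBelow_expectation_image {S : Type*} [Fintype S] {C : Set (S → ℝ)}
    (hC : C ⊆ simplex S) (v : S → ℝ) : BddBelow ((fun p => ∑ s, p s * v s) '' C) := by
  refine ⟨∑ s, -|v s|, ?_⟩
  rintro _ ⟨p, hp, rfl⟩
  obtain ⟨h0, h1⟩ := hC hp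
  refine Finset.sum_le_sum fun s _ => ?_
  have hle : p s ≤ 1 := h1 ▸ Finset.single_le_sum (fun i _ => h0 i) (Finset.mem_univ s)
  have habs : |p s * v s| ≤ |v s| := by
    rw [abs_mul, abs_of_nonneg (h0 s)]
    exact mul_le_of_le_one_left (abs_nonneg _) hle
  linarith [neg_abs_le (p s * v s)]

theorem suppFn_le {S : Type*} [Fintype S] {C : Set (S → ℝ)}
    (hC : C ⊆ simplex S) (v : S → ℝ) {p : S → ℝ} (hp : p ∈ C) :
    suppFn C v ≤ ∑ s, p s * v s :=
  csInf_le (bddBelow_expectation_image hC v) ⟨p, hp, rfl⟩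

theorem expectation_le_add_const {S : Type*} [Fintype S] {p : S → ℝ} (hp : p ∈ simplex S)
    {v w : S → ℝ} {c : ℝ} (h : ∀ s, v s ≤ w s + c) :
    ∑ s, p s * v s ≤ ∑ s, p s * w s + c := by
  calc ∑ s, p s * v s ≤ ∑ s, p s * (w s + c) :=
        Finset.sum_le_sum fun s _ => mul_le_mul_of_nonneg_left (h s) (hp.1 s)
    _ = ∑ s, p s * w s + c := by
        simp only [mul_add, Finset.sum_add_distrib, ← Finset.sum_mul, hp.2, one_mul]

theorem suppFn_le_add_const {S : Type*} [Fintype S] {C : Set (S → ℝ)}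
    (hC : C ⊆ simplex S) (hne : C.Nonempty) {v w : S → ℝ} {c : ℝ}
    (h : ∀ s, v s ≤ w s + c) : suppFn C v ≤ suppFn C w + c := by
  rw [← sub_le_iff_le_add]
  refine le_csInf (hne.image _) ?_
  rintro _ ⟨p, hp, rfl⟩
  rw [sub_le_iff_le_add]
  exact (suppFn_le hC v hp).trans (expectation_le_add_const (hC hp) h)

theorem tvBall_subset_simplex {S : Type*} [Fintype S] (p : S → ℝ) (Γ : ℝ) :
    tvBall p Γ ⊆ simplex S := fun _ hq => hq.1

theorem mem_tvBall_self {S : Type*} [Fintype S] {p : S → ℝ} (hp : p ∈ simplex S) {Γ : ℝ}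
    (hΓ : 0 ≤ Γ) : p ∈ tvBall p Γ := ⟨hp, by simpa using hΓ⟩

theorem average_mem_simplex {S : Type*} [Fintype S] {K : ℕ} [NeZero K]
    {p : Fin K → S → ℝ} (hp : ∀ k, p k ∈ simplex S) :
    (fun s => (K : ℝ)⁻¹ * ∑ k, p k s) ∈ simplex S := by
  refine ⟨fun s => mul_nonneg (by positivity) (Finset.sum_nonneg fun k _ => (hp k).1 s), ?_⟩
  rw [← Finset.mul_sum, Finset.sum_comm]
  simp [(hp _).2, NeZero.ne K]

theorem average_mem_tvBall {S : Type*} [Fintype S] {K : ℕ} [NeZero K]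
    {p q : Fin K → S → ℝ} {Γ : ℝ} (hq : ∀ k, q k ∈ tvBall (p k) Γ) :
    (fun s => (K : ℝ)⁻¹ * ∑ k, q k s) ∈ tvBall (fun s => (K : ℝ)⁻¹ * ∑ k, p k s) Γ := by
  refine ⟨average_mem_simplex fun k => (hq k).1, ?_⟩
  have hK : (K : ℝ) ≠ 0 := Nat.cast_ne_zero.mpr (NeZero.ne K)
  have hpos : (0 : ℝ) ≤ (K : ℝ)⁻¹ := by positivity
  calc (1 / 2) * ∑ s, |(K : ℝ)⁻¹ * ∑ k, q k s - (K : ℝ)⁻¹ * ∑ k, p k s|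
      ≤ (1 / 2) * ∑ s, (K : ℝ)⁻¹ * ∑ k, |q k s - p k s| := by
        gcongr with s
        rw [← mul_sub, ← Finset.sum_sub_distrib, abs_mul, abs_of_nonneg hpos]
        gcongr
        exact Finset.abs_sum_le_sum_abs _ _
    _ = (K : ℝ)⁻¹ * ∑ k, (1 / 2) * ∑ s, |q k s - p k s| := by
        rw [← Finset.mul_sum, Finset.sum_comm, ← Finset.mul_sum]
        ring
    _ ≤ (K : ℝ)⁻¹ * ∑ _k : Fin K, Γ := by
        gcongr with k
        exact (hq k).2
    _ = Γ := by simp [hK]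

/-- The support function of a total-variation ball is convex in the center of the ball. -/
theorem suppFn_tvBall_average_le {S : Type*} [Fintype S] {K : ℕ} [NeZero K]
    {p : Fin K → S → ℝ} (hp : ∀ k, p k ∈ simplex S) {Γ : ℝ} (hΓ : 0 ≤ Γ) (v : S → ℝ) :
    suppFn (tvBall (fun s => (K : ℝ)⁻¹ * ∑ k, p k s) Γ) v ≤
      (K : ℝ)⁻¹ * ∑ k, suppFn (tvBall (p k) Γ) v := by
  have hK : (K : ℝ) ≠ 0 := Nat.cast_ne_zero.mpr (NeZero.ne K)
  refine le_of_forall_pos_le_add fun ε hε => ?_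
  have hex : ∀ k, ∃ q ∈ tvBall (p k) Γ, ∑ s, q s * v s < suppFn (tvBall (p k) Γ) v + ε := by
    intro k
    obtain ⟨_, ⟨q, hq, rfl⟩, hlt⟩ := exists_lt_of_csInf_lt
      (Set.Nonempty.image (fun q : S → ℝ => ∑ s, q s * v s) ⟨p k, mem_tvBall_self (hp k) hΓ⟩)
      (lt_add_of_pos_right (suppFn (tvBall (p k) Γ) v) hε)
    exact ⟨q, hq, hlt⟩
  choose q hq hlt using hex
  calc suppFn (tvBall (fun s => (K : ℝ)⁻¹ * ∑ k, p k s) Γ) v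
      ≤ ∑ s, ((K : ℝ)⁻¹ * ∑ k, q k s) * v s :=
        suppFn_le (tvBall_subset_simplex _ _) v (average_mem_tvBall hq)
    _ = (K : ℝ)⁻¹ * ∑ k, ∑ s, q k s * v s := by
        rw [Finset.sum_comm, Finset.mul_sum]
        simp only [Finset.sum_mul, mul_assoc]
    _ ≤ (K : ℝ)⁻¹ * ∑ k, (suppFn (tvBall (p k) Γ) v + ε) := by
        gcongr with k
        exact (hlt k).le
    _ = (K : ℝ)⁻¹ * ∑ k, suppFn (tvBall (p k) Γ) v + ε := by
        simp [Finset.sum_add_distrib, mul_add, hK]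

/-- A fixed point of the robust Bellman operator lies below every `Q'` that the operator does
not increase. -/
theorem robustOp_fixedPoint_le {S A : Type*} [Fintype S] [Fintype A] [Nonempty S] [Nonempty A]
    {r : S × A → ℝ} {γ : ℝ} (hγ0 : 0 ≤ γ) (hγ1 : γ < 1) {P : S → A → Set (S → ℝ)}
    (hP : ∀ s a, P s a ⊆ simplex S) (hne : ∀ s a, (P s a).Nonempty)
    {π : S → A → ℝ} (hπ : ∀ s, π s ∈ simplex A) {Q Q' : S × A → ℝ}
    (hQ : robustOp r γ P π Q = Q) (hQ' : robustOp r γ P π Q' ≤ Q') : Q ≤ Q' := by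
  obtain ⟨x, hx⟩ := Finite.exists_max fun y => Q y - Q' y
  have hstep : Q x - Q' x ≤ γ * (Q x - Q' x) := by
    have hσ := suppFn_le_add_const (hP x.1 x.2) (hne x.1 x.2)
      (v := fun s => ∑ a, π s a * Q (s, a)) (w := fun s => ∑ a, π s a * Q' (s, a))
      (c := Q x - Q' x) fun s => expectation_le_add_const (hπ s) fun a => by
        linarith [hx (s, a)]
    have hmul := mul_le_mul_of_nonneg_left hσ hγ0
    have hQx := congrFun hQ x
    have hQx' := hQ' x
    simp only [robustOp] at hQx hQx'
    linarith
  intro y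
  have hy := hx y
  have hx0 : Q x - Q' x ≤ 0 := by nlinarith
  linarith

/-- For total-variation uncertainty sets, the proximal robust DR proxy `V_𝒫̄^π`
(robust value of the ball around the averaged kernel) is dominated by the
averaged-operator proxy `V_AO^π`. -/
theorem proximal_robust_DR_le_averaged {S A : Type*} [Fintype S] [Fintype A]
    [Nonempty S] [Nonempty A]
    (r : S × A → ℝ) (hr : ∀ sa, 0 ≤ r sa ∧ r sa ≤ 1)
    (γ : ℝ) (hγ0 : 0 ≤ γ) (hγ1 : γ < 1)
    (K : ℕ) [NeZero K]
    (Pk : Fin K → S → A → (S → ℝ)) (hPk : ∀ k s a, Pk k s a ∈ simplex S)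
    (Γ : S → A → ℝ) (hΓ : ∀ s a, 0 ≤ Γ s a)
    (π : S → A → ℝ) (hπ : ∀ s, π s ∈ simplex A)
    (Qbar : S × A → ℝ)
    (hQbar : robustOp r γ
      (fun s a => tvBall (fun s' => (K : ℝ)⁻¹ * ∑ k, Pk k s a s') (Γ s a)) π Qbar = Qbar)
    (QAO : S × A → ℝ)
    (hQAO : (fun sa => (K : ℝ)⁻¹ *
      ∑ k, robustOp r γ (fun s a => tvBall (Pk k s a) (Γ s a)) π QAO sa) = QAO) :
    ∀ s, ∑ a, π s a * Qbar (s, a) ≤ ∑ a, π s a * QAO (s, a) := by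
  have hK : (K : ℝ) ≠ 0 := Nat.cast_ne_zero.mpr (NeZero.ne K)
  have hle : Qbar ≤ QAO := by
    refine robustOp_fixedPoint_le hγ0 hγ1 (fun s a => tvBall_subset_simplex _ _)
      (fun s a => ⟨_, mem_tvBall_self (average_mem_simplex fun k => hPk k s a) (hΓ s a)⟩)
      hπ hQbar fun x => ?_
    have hσ := mul_le_mul_of_nonneg_left (suppFn_tvBall_average_le
      (fun k => hPk k x.1 x.2) (hΓ x.1 x.2) fun s => ∑ a, π s a * QAO (s, a)) hγ0
    have hx : (K : ℝ)⁻¹ * ∑ k, robustOp r γ (fun s a => tvBall (Pk k s a) (Γ s a)) π QAO x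
        = QAO x := congrFun hQAO x
    rw [← hx]
    simp only [robustOp, Finset.sum_add_distrib, ← Finset.mul_sum, mul_add, Finset.sum_const,
      Finset.card_univ, Fintype.card_fin, nsmul_eq_mul, inv_mul_cancel_left₀ hK]
    linarith
  exact fun s => Finset.sum_le_sum fun a _ =>
    mul_le_mul_of_nonneg_left (hle (s, a)) ((hπ s).1 a)
end
end

section
/- Let Q_AO be the unique fixed point of the averaged optimal robust Bellman operator T_AO, and let V_AO(s) = max_a Q_AO(s,a). Let π_* be a deterministic policy with π_*(s) ∈ argmax_a Q_AO(s,a) for every s. Then: (i) Q_AO is also the unique fixed point of T_AO^{π_*}, i.e., Q_AO^{π_*} = Q_AO and V_AO^{π_*} = V_AO; and (ii) for every policy π and every state s, V_AO^π(s) ≤ V_AO(s). Consequently π_* maximizes V_AO^π over all policies. -/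
noncomputable section

theorem suppFn_le_suppFn_add {S : Type*} [Fintype S] {C : Set (S → ℝ)} (hne : C.Nonempty)
    (hC : C ⊆ simplex S) {v w : S → ℝ} {c : ℝ} (h : ∀ s, v s ≤ w s + c) :
    suppFn C v ≤ suppFn C w + c := by
  have hbdd : BddBelow ((fun p => ∑ s, p s * v s) '' C) := by
    refine ⟨-∑ s, |v s|, ?_⟩
    rintro _ ⟨p, hp, rfl⟩
    obtain ⟨h0, h1⟩ := hC hp
    rw [← Finset.sum_neg_distrib]
    refine Finset.sum_le_sum fun s _ => ?_
    have hp1 : p s ≤ 1 := h1 ▸ Finset.single_le_sum (fun i _ => h0 i) (Finset.mem_univ s)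
    nlinarith [abs_nonneg (v s), mul_le_mul_of_nonneg_left (neg_abs_le (v s)) (h0 s)]
  rw [← sub_le_iff_le_add]
  refine le_csInf (hne.image _) ?_
  rintro _ ⟨p, hp, rfl⟩
  rw [sub_le_iff_le_add]
  refine (csInf_le hbdd ⟨p, hp, rfl⟩).trans ?_
  obtain ⟨h0, h1⟩ := hC hp
  calc ∑ s, p s * v s ≤ ∑ s, p s * (w s + c) :=
        Finset.sum_le_sum fun s _ => mul_le_mul_of_nonneg_left (h s) (h0 s)
    _ = ∑ s, p s * w s + c := by
        simp only [mul_add, Finset.sum_add_distrib, ← Finset.sum_mul, h1, one_mul]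

theorem sum_simplex_mul_le {A : Type*} [Fintype A] {p : A → ℝ} (hp : p ∈ simplex A)
    {f : A → ℝ} {c : ℝ} (h : ∀ a, f a ≤ c) : ∑ a, p a * f a ≤ c := by
  calc ∑ a, p a * f a ≤ ∑ a, p a * c :=
        Finset.sum_le_sum fun a _ => mul_le_mul_of_nonneg_left (h a) (hp.1 a)
    _ = c := by rw [← Finset.sum_mul, hp.2, one_mul]

/-- Comparison principle: if an upper bound `c` on `Q - R` also bounds `v - w`, where `v` and `w`
are the state values used to back up `Q` and `R`, then `Q ≤ R`. -/
theorem averaged_backup_comparison {S A : Type*} [Fintype S] [Fintype A] [Nonempty S] [Nonempty A]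
    {r : S × A → ℝ} {γ : ℝ} (hγ0 : 0 ≤ γ) (hγ1 : γ < 1) {K : ℕ} [NeZero K]
    {P : Fin K → S → A → Set (S → ℝ)} (hne : ∀ k s a, (P k s a).Nonempty)
    (hP : ∀ k s a, P k s a ⊆ simplex S) {Q R : S × A → ℝ} {v w : S → ℝ}
    (hQ : (fun sa : S × A => (K : ℝ)⁻¹ * ∑ k, (r sa + γ * suppFn (P k sa.1 sa.2) v)) = Q)
    (hR : (fun sa : S × A => (K : ℝ)⁻¹ * ∑ k, (r sa + γ * suppFn (P k sa.1 sa.2) w)) = R)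
    (h : ∀ c, (∀ sa, Q sa ≤ R sa + c) → ∀ s, v s ≤ w s + c) (sa : S × A) :
    Q sa ≤ R sa := by
  obtain ⟨m, hm⟩ := Finite.exists_max fun sa => Q sa - R sa
  have hvw := h (Q m - R m) fun sa => by linarith [hm sa]
  have hK : (K : ℝ) ≠ 0 := NeZero.ne _
  have key : Q m ≤ R m + γ * (Q m - R m) := by
    calc Q m = (K : ℝ)⁻¹ * ∑ k, (r m + γ * suppFn (P k m.1 m.2) v) := (congrFun hQ m).symm
      _ ≤ (K : ℝ)⁻¹ * ∑ k, ((r m + γ * suppFn (P k m.1 m.2) w) + γ * (Q m - R m)) := by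
          refine mul_le_mul_of_nonneg_left (Finset.sum_le_sum fun k _ => ?_) (by positivity)
          have := mul_le_mul_of_nonneg_left
            (suppFn_le_suppFn_add (hne k m.1 m.2) (hP k m.1 m.2) hvw) hγ0
          linarith
      _ = R m + γ * (Q m - R m) := by
          rw [Finset.sum_add_distrib, mul_add, ← congrFun hR m]
          simp [hK]
  have : Q m - R m ≤ 0 := by nlinarith
  linarith [hm sa]

/-- **Optimality of the greedy policy for the averaged operator.**
Let `QAO` be the fixed point of the averaged optimal robust Bellman operator and
`πstar` a greedy deterministic policy w.r.t. `QAO`.  Then (i) `QAO` is the unique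
fixed point of the averaged robust Bellman operator of `πstar` (so
`Q_AO^{πstar} = Q_AO` and `V_AO^{πstar} = V_AO`), and (ii) every policy's
averaged-operator value function is dominated by `V_AO(s) = max_a QAO(s,a)`;
consequently `πstar` maximizes `V_AO^π`. -/
theorem averaged_optimal_operator_greedy {S A : Type*} [Fintype S] [Fintype A]
    [Nonempty S] [Nonempty A] [DecidableEq A]
    (r : S × A → ℝ) (hr : ∀ sa, 0 ≤ r sa ∧ r sa ≤ 1)
    (γ : ℝ) (hγ0 : 0 ≤ γ) (hγ1 : γ < 1)
    (K : ℕ) [NeZero K]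
    (P : Fin K → S → A → Set (S → ℝ))
    (hP : ∀ k s a, (P k s a).Nonempty ∧ IsCompact (P k s a) ∧ P k s a ⊆ simplex S)
    (QAO : S × A → ℝ)
    (hQAO : (fun sa => (K : ℝ)⁻¹ * ∑ k, optRobustOp r γ (P k) QAO sa) = QAO)
    (πstar : S → A) (hπstar : ∀ s a, QAO (s, a) ≤ QAO (s, πstar s)) :
    ((fun sa => (K : ℝ)⁻¹ * ∑ k,
        robustOp r γ (P k) (fun s a => if a = πstar s then 1 else 0) QAO sa) = QAO
      ∧ ∀ Q : S × A → ℝ,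
        (fun sa => (K : ℝ)⁻¹ * ∑ k,
          robustOp r γ (P k) (fun s a => if a = πstar s then 1 else 0) Q sa) = Q →
        Q = QAO)
    ∧ ∀ π : S → A → ℝ, (∀ s, π s ∈ simplex A) →
        ∀ Qπ : S × A → ℝ,
          (fun sa => (K : ℝ)⁻¹ * ∑ k, robustOp r γ (P k) π Qπ sa) = Qπ →
          ∀ s, ∑ a, π s a * Qπ (s, a)
            ≤ Finset.univ.sup' Finset.univ_nonempty (fun a => QAO (s, a)) := by
  have hne := fun k s a => (hP k s a).1
  have hsub := fun k s a => (hP k s a).2.2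
  have hmax : ∀ s, Finset.univ.sup' Finset.univ_nonempty (fun a => QAO (s, a))
      = QAO (s, πstar s) := fun s =>
    le_antisymm (Finset.sup'_le _ _ fun a _ => hπstar s a)
      (Finset.le_sup' (fun a => QAO (s, a)) (Finset.mem_univ _))
  have hgreedy : (fun sa => (K : ℝ)⁻¹ * ∑ k,
      robustOp r γ (P k) (fun s a => if a = πstar s then 1 else 0) QAO sa) = QAO := by
    conv_rhs => rw [← hQAO]
    simp [robustOp, optRobustOp, hmax]
  refine ⟨⟨hgreedy, fun Q hQ => ?_⟩, fun π hπ Qπ hQπ s => ?_⟩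
  · funext sa
    refine le_antisymm
      (averaged_backup_comparison hγ0 hγ1 hne hsub hQ hgreedy (fun c hc s => ?_) sa)
      (averaged_backup_comparison hγ0 hγ1 hne hsub hgreedy hQ (fun c hc s => ?_) sa)
    all_goals simpa using hc (s, πstar s)
  · rw [hmax]
    refine sum_simplex_mul_le (hπ s) fun a => le_trans ?_ (hπstar s a)
    refine averaged_backup_comparison hγ0 hγ1 hne hsub hQπ hQAO (fun c hc s => ?_) (s, a)
    rw [hmax]
    exact sum_simplex_mul_le (hπ s) fun a => by linarith [hc (s, a), hπstar s a]
end
end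

section
/- (Convergence of MDTL-Avg with exact operators.) Assume λ ≤ 1/E, 4γλ(E−1) ≤ 1−γ, (1−γ)T ≥ 2λE², and that the heterogeneity bound |σ_{(𝒫_k)_s^a}(V_AO) − (1/K) Σ_{j=1}^K σ_{(𝒫_j)_s^a}(V_AO)| ≤ Γ/(1−γ) holds for all k, s, a, where V_AO(s) = max_a Q_AO(s,a). Then the MDTL-Avg iterates satisfy ‖Q_AO − Q̄^T‖ ≤ (4/(1−γ)²)·exp(−(1/2)·√((1−γ)λT)) + (2γ²/(1−γ)²)·(6λ²(E−1)² + λ(E−1))·Γ. -/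
noncomputable section

/-- The support function of a nonempty family of distributions is `1`-Lipschitz. -/
theorem abs_suppFn_sub_suppFn_le {S : Type*} [Fintype S] {C : Set (S → ℝ)} (hC : C.Nonempty)
    (hCs : C ⊆ simplex S) (v w : S → ℝ) : |suppFn C v - suppFn C w| ≤ ‖v - w‖ := by
  have key : ∀ v w : S → ℝ, ∀ p ∈ C, ∑ s, p s * v s - ‖v - w‖ ≤ ∑ s, p s * w s := by
    intro v w p hp
    obtain ⟨h0, h1⟩ := hCs hp
    calc ∑ s, p s * v s - ‖v - w‖ = ∑ s, p s * (v s - ‖v - w‖) := by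
          simp only [mul_sub, Finset.sum_sub_distrib, ← Finset.sum_mul, h1, one_mul]
      _ ≤ ∑ s, p s * w s := by
          refine Finset.sum_le_sum fun s _ => mul_le_mul_of_nonneg_left ?_ (h0 s)
          have h := (Real.le_norm_self _).trans (norm_le_pi_norm (v - w) s)
          rw [Pi.sub_apply] at h
          linarith
  have bdd : ∀ v : S → ℝ, BddBelow ((fun p => ∑ s, p s * v s) '' C) := by
    intro v
    refine ⟨-‖v‖, ?_⟩
    rintro _ ⟨p, hp, rfl⟩
    simpa using key 0 v p hp
  have le : ∀ v w : S → ℝ, suppFn C v - ‖v - w‖ ≤ suppFn C w := by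
    intro v w
    refine le_csInf (hC.image _) ?_
    rintro _ ⟨p, hp, rfl⟩
    exact (sub_le_sub_right (csInf_le (bdd v) ⟨p, hp, rfl⟩) _).trans (key v w p hp)
  have h1 := le v w
  have h2 := le w v
  rw [norm_sub_rev] at h2
  exact abs_sub_le_iff.2 ⟨by linarith, by linarith⟩

theorem abs_sup'_sub_sup'_le {A : Type*} [Fintype A] [Nonempty A] {f g : A → ℝ} {c : ℝ}
    (h : ∀ a, |f a - g a| ≤ c) :
    |Finset.univ.sup' Finset.univ_nonempty f - Finset.univ.sup' Finset.univ_nonempty g| ≤ c := by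
  have le : ∀ f g : A → ℝ, (∀ a, |f a - g a| ≤ c) →
      Finset.univ.sup' Finset.univ_nonempty f ≤
        Finset.univ.sup' Finset.univ_nonempty g + c := by
    intro f g h
    refine Finset.sup'_le _ _ fun a ha => ?_
    have h1 := Finset.le_sup' g ha
    have h2 := (abs_le.1 (h a)).2
    linarith
  have h1 := le f g h
  have h2 := le g f fun a => by rw [abs_sub_comm]; exact h a
  exact abs_sub_le_iff.2 ⟨by linarith, by linarith⟩

/-- The optimal robust Bellman operator is `γ`-Lipschitz in the supremum norm. -/
theorem norm_optRobustOp_sub_le {S A : Type*} [Fintype S] [Fintype A] [Nonempty A]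
    (r : S × A → ℝ) {γ : ℝ} (hγ0 : 0 ≤ γ) {P : S → A → Set (S → ℝ)}
    (hP : ∀ s a, (P s a).Nonempty ∧ P s a ⊆ simplex S) (Q Q' : S × A → ℝ) :
    ‖optRobustOp r γ P Q - optRobustOp r γ P Q'‖ ≤ γ * ‖Q - Q'‖ := by
  refine (pi_norm_le_iff_of_nonneg (by positivity)).2 fun sa => ?_
  simp only [Pi.sub_apply, optRobustOp, add_sub_add_left_eq_sub, ← mul_sub, Real.norm_eq_abs,
    abs_mul, abs_of_nonneg hγ0]
  refine mul_le_mul_of_nonneg_left ?_ hγ0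
  refine (abs_suppFn_sub_suppFn_le (hP sa.1 sa.2).1 (hP sa.1 sa.2).2 _ _).trans ?_
  refine (pi_norm_le_iff_of_nonneg (norm_nonneg _)).2 fun s => ?_
  exact abs_sup'_sub_sup'_le fun a => norm_le_pi_norm (Q - Q') (s, a)

theorem norm_optRobustOp_le {S A : Type*} [Fintype S] [Fintype A] [Nonempty A]
    {r : S × A → ℝ} (hr : ∀ sa, 0 ≤ r sa ∧ r sa ≤ 1) {γ : ℝ} (hγ0 : 0 ≤ γ)
    {P : S → A → Set (S → ℝ)} (hP : ∀ s a, (P s a).Nonempty ∧ P s a ⊆ simplex S)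
    (Q : S × A → ℝ) : ‖optRobustOp r γ P Q‖ ≤ 1 + γ * ‖Q‖ := by
  have h0 : optRobustOp r γ P 0 = r := by
    funext sa
    simp [optRobustOp, suppFn, (hP sa.1 sa.2).1]
  have hr1 : ‖r‖ ≤ 1 := (pi_norm_le_iff_of_nonneg zero_le_one).2 fun sa => by
    rw [Real.norm_eq_abs, abs_of_nonneg (hr sa).1]
    exact (hr sa).2
  have h := norm_optRobustOp_sub_le r hγ0 hP Q 0
  rw [h0, sub_zero] at h
  linarith [norm_le_norm_add_norm_sub' (optRobustOp r γ P Q) r]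

theorem norm_average_le {X : Type*} [NormedAddCommGroup X] [NormedSpace ℝ X] {K : ℕ} [NeZero K]
    {f : Fin K → X} {c : ℝ} (h : ∀ k, ‖f k‖ ≤ c) : ‖(K : ℝ)⁻¹ • ∑ k, f k‖ ≤ c := by
  have hK : (0 : ℝ) < K := by exact_mod_cast Nat.pos_of_ne_zero (NeZero.ne K)
  rw [norm_smul, norm_inv, Real.norm_of_nonneg hK.le, inv_mul_le_iff₀ hK]
  simpa using norm_sum_le_of_le Finset.univ fun k _ => h k

theorem average_const {X : Type*} [AddCommGroup X] [Module ℝ X] {K : ℕ} [NeZero K]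
    (x : X) : (K : ℝ)⁻¹ • ∑ _k : Fin K, x = x := by
  have hK : (K : ℝ) ≠ 0 := by exact_mod_cast NeZero.ne K
  rw [Finset.sum_const, Finset.card_univ, Fintype.card_fin, ← Nat.cast_smul_eq_nsmul ℝ,
    smul_smul, inv_mul_cancel₀ hK, one_smul]

theorem one_sub_pow_le_one_sub_half {z : ℝ} {n : ℕ} (hz0 : 0 ≤ z) (hz1 : z ≤ 1)
    (hnz : n * z ≤ 1) : (1 - z) ^ n ≤ 1 - n * z / 2 := by
  have hx : 0 ≤ n * z := by positivity
  calc (1 - z) ^ n ≤ Real.exp (-z) ^ n :=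
        pow_le_pow_left₀ (by linarith) (Real.one_sub_le_exp_neg z) n
    _ = (Real.exp (n * z))⁻¹ := by rw [← Real.exp_nat_mul, mul_neg, Real.exp_neg]
    _ ≤ (1 + n * z)⁻¹ := by
        refine inv_anti₀ (by linarith) ?_
        linarith [Real.add_one_le_exp (n * z)]
    _ ≤ 1 - n * z / 2 := by
        rw [inv_le_iff_one_le_mul₀ (by linarith)]
        nlinarith

/-- Error of periodically averaged damped iterations of `γ`-contractions whose average fixes `x`,
when each contraction moves `x` by at most `δ`. -/
theorem norm_average_sub_le_of_periodic_averaging {X : Type*} [NormedAddCommGroup X]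
    [NormedSpace ℝ X] {K : ℕ} [NeZero K] {F : Fin K → X → X} {γ lam δ : ℝ} {x : X}
    (hγ0 : 0 ≤ γ) (hγ1 : γ < 1) (hF : ∀ k y z, ‖F k y - F k z‖ ≤ γ * ‖y - z‖)
    (hx : (K : ℝ)⁻¹ • ∑ k, F k x = x) (hδ0 : 0 ≤ δ) (hδ : ∀ k, ‖F k x - x‖ ≤ δ)
    (hlam0 : 0 ≤ lam) (hlam1 : lam ≤ 1) {E : ℕ} (hE : 1 ≤ E) (hlamE : lam * E ≤ 1)
    {q : ℕ → Fin K → X} {q0 : X} (hinit : ∀ k, q 0 k = q0)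
    (hstep : ∀ t k, q (t + 1) k =
      if (t + 1) % E = 0 then (K : ℝ)⁻¹ • ∑ j, ((1 - lam) • q t j + lam • F j (q t j))
      else (1 - lam) • q t k + lam • F k (q t k)) (t : ℕ) :
    ‖(K : ℝ)⁻¹ • ∑ k, q t k - x‖ ≤
      (1 - lam * (1 - γ)) ^ t * ‖q0 - x‖ + 2 * γ * lam * (E - 1) * δ / (1 - γ) := by
  have h1γ : 0 < 1 - γ := by linarith
  have hE' : (1 : ℝ) ≤ E := by exact_mod_cast hE
  set ρ : ℝ := 1 - lam * (1 - γ) with hρ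
  have hz0 : 0 ≤ lam * (1 - γ) := by positivity
  have hz1 : lam * (1 - γ) ≤ 1 := by nlinarith
  have hρ0 : 0 ≤ ρ := by linarith
  have hρ1 : ρ ≤ 1 := by linarith
  set b : ℝ := γ * lam * (E - 1) * δ / (1 - γ) with hb
  have hEm : (0 : ℝ) ≤ E - 1 := by linarith
  have hb0 : 0 ≤ b := by positivity
  set D := ‖q0 - x‖
  have hround : ρ ^ E * b + γ * lam ^ 2 * δ * (E * (E - 1) / 2) ≤ b := by
    have h := one_sub_pow_le_one_sub_half (n := E) hz0 hz1 (by nlinarith)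
    have h2 := mul_le_mul_of_nonneg_right h hb0
    have h3 : E * (lam * (1 - γ)) / 2 * b = γ * lam ^ 2 * δ * (E * (E - 1) / 2) := by
      rw [hb]; field_simp
    rw [← hρ] at h2
    linarith
  have havg : ∀ t, (K : ℝ)⁻¹ • ∑ k, q (t + 1) k =
      (K : ℝ)⁻¹ • ∑ j, ((1 - lam) • q t j + lam • F j (q t j)) := by
    intro t
    by_cases h : (t + 1) % E = 0
    · simp only [hstep, h, if_true, average_const]
    · simp only [hstep, h, if_false]
  have hinv : ∀ t, (∀ k, ‖q t k - x‖ ≤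
        ρ ^ t * D + ρ ^ (t % E) * b + lam * δ * (t % E : ℕ)) ∧
      ‖(K : ℝ)⁻¹ • ∑ k, q t k - x‖ ≤ ρ ^ t * D + ρ ^ (t % E) * b
        + γ * lam ^ 2 * δ * ((t % E : ℕ) * ((t % E : ℕ) - 1) / 2) := by
    intro t
    induction t with
    | zero =>
      simp only [hinit, average_const]
      simp [D, hb0]
    | succ t ih =>
      obtain ⟨ihk, iha⟩ := ih
      set i := t % E with hi
      have hloc : ∀ k, ‖(1 - lam) • q t k + lam • F k (q t k) - x‖ ≤
          ρ ^ (t + 1) * D + ρ ^ (i + 1) * b + lam * δ * ((i + 1 : ℕ) : ℝ) := by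
        intro k
        have hdec : (1 - lam) • q t k + lam • F k (q t k) - x =
            (1 - lam) • (q t k - x) + lam • (F k (q t k) - F k x) + lam • (F k x - x) := by
          module
        have h1 := norm_add₃_le (a := (1 - lam) • (q t k - x))
          (b := lam • (F k (q t k) - F k x)) (c := lam • (F k x - x))
        rw [← hdec, norm_smul, norm_smul, norm_smul, Real.norm_of_nonneg hlam0,
          Real.norm_of_nonneg (sub_nonneg.2 hlam1)] at h1
        have h2 := mul_le_mul_of_nonneg_left (hF k (q t k) x) hlam0
        have h3 := mul_le_mul_of_nonneg_left (hδ k) hlam0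
        have h4 := mul_le_mul_of_nonneg_left (ihk k) hρ0
        have h5 : ρ * (lam * δ * i) ≤ lam * δ * i :=
          mul_le_of_le_one_left (by positivity) hρ1
        push_cast
        rw [pow_succ, pow_succ]
        have h6 : ρ * ‖q t k - x‖ = (1 - lam) * ‖q t k - x‖ + lam * (γ * ‖q t k - x‖) := by
          rw [hρ]; ring
        linarith
      have hglob : ‖(K : ℝ)⁻¹ • ∑ k, q (t + 1) k - x‖ ≤ ρ ^ (t + 1) * D + ρ ^ (i + 1) * b
          + γ * lam ^ 2 * δ * (((i + 1 : ℕ) : ℝ) * (((i + 1 : ℕ) : ℝ) - 1) / 2) := by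
        have hdec : (K : ℝ)⁻¹ • ∑ k, q (t + 1) k - x =
            (1 - lam) • ((K : ℝ)⁻¹ • ∑ k, q t k - x)
              + lam • ((K : ℝ)⁻¹ • ∑ k, (F k (q t k) - F k x)) := by
          rw [havg, Finset.sum_sub_distrib, smul_sub (K : ℝ)⁻¹, hx, Finset.sum_add_distrib,
            ← Finset.smul_sum, ← Finset.smul_sum]
          module
        have h1 := norm_add_le ((1 - lam) • ((K : ℝ)⁻¹ • ∑ k, q t k - x))
          (lam • ((K : ℝ)⁻¹ • ∑ k, (F k (q t k) - F k x)))
        rw [← hdec, norm_smul, norm_smul, Real.norm_of_nonneg hlam0,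
          Real.norm_of_nonneg (sub_nonneg.2 hlam1)] at h1
        have h2 := mul_le_mul_of_nonneg_left (norm_average_le fun k =>
          (hF k (q t k) x).trans (mul_le_mul_of_nonneg_left (ihk k) hγ0)) hlam0
        have h3 := mul_le_mul_of_nonneg_left iha (sub_nonneg.2 hlam1)
        have hi2 : (0 : ℝ) ≤ i * (i - 1) := by
          rcases Nat.eq_zero_or_pos i with h | h
          · simp [h]
          · have : (1 : ℝ) ≤ i := by exact_mod_cast h
            nlinarith
        have h4 : 0 ≤ lam * (γ * lam ^ 2 * δ * (i * (i - 1) / 2)) := by positivity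
        push_cast
        rw [pow_succ, pow_succ]
        have h5 : (1 - lam) * (ρ ^ t * D + ρ ^ i * b) + lam * (γ * (ρ ^ t * D + ρ ^ i * b)) =
            ρ ^ t * ρ * D + ρ ^ i * ρ * b := by
          rw [hρ]; ring
        linarith
      by_cases h : (t + 1) % E = 0
      · have hiE : i + 1 = E := by
          have hlt : i < E := Nat.mod_lt _ hE
          have h' : (i + 1) % E = 0 := by rw [hi, Nat.mod_add_mod]; exact h
          have := Nat.le_of_dvd i.succ_pos (Nat.dvd_of_mod_eq_zero h')
          omega
        have hsync : ‖(K : ℝ)⁻¹ • ∑ k, q (t + 1) k - x‖ ≤ ρ ^ (t + 1) * D + b := by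
          rw [hiE] at hglob
          linarith
        refine ⟨fun k => ?_, by simpa [h] using hsync⟩
        rw [hstep, if_pos h, ← havg]
        simpa [h] using hsync
      · have hiE : (t + 1) % E = i + 1 := by
          have hlt : i < E := Nat.mod_lt _ hE
          have h' : (i + 1) % E = (t + 1) % E := by rw [hi, Nat.mod_add_mod]
          rcases Nat.lt_or_ge (i + 1) E with h2 | h2
          · rw [← h', Nat.mod_eq_of_lt h2]
          · have : i + 1 = E := by omega
            rw [← h', this, Nat.mod_self] at h
            exact absurd rfl h
        rw [hiE]
        refine ⟨fun k => ?_, hglob⟩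
        rw [hstep, if_neg h]
        exact hloc k
  refine (hinv t).2.trans ?_
  have hiE : (t % E : ℕ) + (1 : ℝ) ≤ E := by exact_mod_cast Nat.mod_lt t hE
  set i := t % E
  have hi0 : (0 : ℝ) ≤ i := by positivity
  have h1 : ρ ^ i * b ≤ b := mul_le_of_le_one_left hb0 (pow_le_one₀ hρ0 hρ1)
  have h2 : γ * lam ^ 2 * δ * (i * (i - 1) / 2) ≤ b := by
    rw [hb, le_div_iff₀ h1γ]
    have h3 : lam * (i * (i - 1) / 2) * (1 - γ) ≤ E - 1 := by
      have h4 : lam * i ≤ 1 := by nlinarith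
      have h5 : (0 : ℝ) ≤ lam * i := by positivity
      have h6 : lam * i * (i - 1) ≤ E - 1 := by nlinarith
      nlinarith
    have := mul_le_mul_of_nonneg_left h3 (show 0 ≤ γ * lam * δ by positivity)
    linarith
  have h3 : 2 * γ * lam * (E - 1) * δ / (1 - γ) = b + b := by rw [hb]; ring
  linarith

theorem exp_neg_le_two_mul_exp_neg_half_sqrt {y : ℝ} (hy : 0 ≤ y) :
    Real.exp (-y) ≤ 2 * Real.exp (-(1 / 2) * Real.sqrt y) := by
  have h1 : -y ≤ 1 / 2 + -(1 / 2) * Real.sqrt y := by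
    nlinarith [Real.sq_sqrt hy, sq_nonneg (Real.sqrt y - 1 / 4)]
  have h2 : Real.exp (1 / 2) ≤ 2 := by
    have h3 : Real.exp (1 / 2) ^ 2 = Real.exp 1 := by rw [← Real.exp_nat_mul]; norm_num
    nlinarith [Real.exp_one_lt_d9, Real.exp_pos (1 / 2)]
  calc Real.exp (-y) ≤ Real.exp (1 / 2 + -(1 / 2) * Real.sqrt y) := Real.exp_le_exp.2 h1
    _ = Real.exp (1 / 2) * Real.exp (-(1 / 2) * Real.sqrt y) := Real.exp_add _ _
    _ ≤ _ := mul_le_mul_of_nonneg_right h2 (Real.exp_pos _).le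

/-- **Convergence of MDTL-Avg with exact operators.**  Under step-size and
synchronization-period conditions, the averaged iterate `Q̄^T` of the MDTL-Avg
algorithm converges to the fixed point `QAO` of the averaged optimal robust
Bellman operator at the stated rate. -/
theorem mdtl_avg_convergence {S A : Type*} [Fintype S] [Fintype A]
    [Nonempty S] [Nonempty A]
    (r : S × A → ℝ) (hr : ∀ sa, 0 ≤ r sa ∧ r sa ≤ 1)
    (γ : ℝ) (hγ0 : 0 ≤ γ) (hγ1 : γ < 1)
    (K : ℕ) [NeZero K]
    (P : Fin K → S → A → Set (S → ℝ))
    (hP : ∀ k s a, (P k s a).Nonempty ∧ IsCompact (P k s a) ∧ P k s a ⊆ simplex S)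
    (QAO : S × A → ℝ)
    (hQAO : (fun sa => (K : ℝ)⁻¹ * ∑ k, optRobustOp r γ (P k) QAO sa) = QAO)
    (lam : ℝ) (hlam0 : 0 < lam) (hlam1 : lam ≤ 1)
    (E T : ℕ) (hE : 1 ≤ E)
    (hlamE : lam ≤ 1 / (E : ℝ))
    (hEγ : 4 * γ * lam * ((E : ℝ) - 1) ≤ 1 - γ)
    (hT : 2 * lam * (E : ℝ) ^ 2 ≤ (1 - γ) * (T : ℝ))
    (Γ : ℝ) (hΓ0 : 0 ≤ Γ)
    (hhet : ∀ k s a,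
      |suppFn (P k s a)
          (fun s' => Finset.univ.sup' Finset.univ_nonempty (fun a' => QAO (s', a')))
        - (K : ℝ)⁻¹ * ∑ j, suppFn (P j s a)
          (fun s' => Finset.univ.sup' Finset.univ_nonempty (fun a' => QAO (s', a')))|
        ≤ Γ / (1 - γ))
    (Q0 : S × A → ℝ) (hQ0 : ∀ sa, 0 ≤ Q0 sa ∧ Q0 sa ≤ 1 / (1 - γ))
    (Qk : ℕ → Fin K → (S × A → ℝ))
    (hinit : ∀ k, Qk 0 k = Q0)
    (hstep : ∀ t k, Qk (t + 1) k =
      if (t + 1) % E = 0 then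
        (K : ℝ)⁻¹ • ∑ j, ((1 - lam) • Qk t j + lam • optRobustOp r γ (P j) (Qk t j))
      else (1 - lam) • Qk t k + lam • optRobustOp r γ (P k) (Qk t k)) :
    ‖QAO - (K : ℝ)⁻¹ • ∑ k, Qk T k‖ ≤
      4 / (1 - γ) ^ 2 * Real.exp (-(1 / 2) * Real.sqrt ((1 - γ) * lam * T))
        + 2 * γ ^ 2 / (1 - γ) ^ 2 * (6 * lam ^ 2 * ((E : ℝ) - 1) ^ 2
            + lam * ((E : ℝ) - 1)) * Γ := by
  have h1γ : 0 < 1 - γ := by linarith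
  have hE' : (1 : ℝ) ≤ E := by exact_mod_cast hE
  have hEm : (0 : ℝ) ≤ E - 1 := by linarith
  have hP' : ∀ k s a, (P k s a).Nonempty ∧ P k s a ⊆ simplex S :=
    fun k s a => ⟨(hP k s a).1, (hP k s a).2.2⟩
  have hfix : (K : ℝ)⁻¹ • ∑ k, optRobustOp r γ (P k) QAO = QAO := by
    refine Eq.trans ?_ hQAO
    funext sa
    simp
  have hhet' : ∀ k, ‖optRobustOp r γ (P k) QAO - QAO‖ ≤ γ * (Γ / (1 - γ)) := by
    intro k
    refine (pi_norm_le_iff_of_nonneg (by positivity)).2 fun sa => ?_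
    have h : QAO sa = r sa + γ * ((K : ℝ)⁻¹ * ∑ j, suppFn (P j sa.1 sa.2)
        (fun s' => Finset.univ.sup' Finset.univ_nonempty (fun a' => QAO (s', a')))) := by
      have hc : (K : ℝ)⁻¹ * ∑ _j : Fin K, r sa = r sa := average_const (r sa)
      calc QAO sa = (K : ℝ)⁻¹ * ∑ k, optRobustOp r γ (P k) QAO sa := (congrFun hQAO sa).symm
        _ = _ := by
          simp only [optRobustOp]
          rw [Finset.sum_add_distrib, mul_add, hc, ← Finset.mul_sum]
          ring
    rw [Pi.sub_apply, h, optRobustOp, add_sub_add_left_eq_sub, ← mul_sub, Real.norm_eq_abs,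
      abs_mul, abs_of_nonneg hγ0]
    exact mul_le_mul_of_nonneg_left (hhet k sa.1 sa.2) hγ0
  have hnorm : ‖QAO‖ ≤ 1 / (1 - γ) := by
    have h := norm_average_le fun k => norm_optRobustOp_le hr hγ0 (hP' k) QAO
    rw [hfix] at h
    rw [le_div_iff₀ h1γ]
    linarith
  have hnorm0 : ‖Q0‖ ≤ 1 / (1 - γ) := (pi_norm_le_iff_of_nonneg (by positivity)).2 fun sa => by
    rw [Real.norm_eq_abs, abs_of_nonneg (hQ0 sa).1]
    exact (hQ0 sa).2
  have hD : ‖Q0 - QAO‖ ≤ 2 / (1 - γ) ^ 2 := by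
    have h : 1 / (1 - γ) ≤ 1 / (1 - γ) ^ 2 :=
      one_div_le_one_div_of_le (by positivity) (by nlinarith)
    have h2 : 2 / (1 - γ) ^ 2 = 1 / (1 - γ) ^ 2 + 1 / (1 - γ) ^ 2 := by ring
    linarith [norm_sub_le Q0 QAO]
  have hlamE' : lam * E ≤ 1 := by rwa [le_div_iff₀ (by linarith)] at hlamE
  have hmain := norm_average_sub_le_of_periodic_averaging hγ0 hγ1
    (fun k => norm_optRobustOp_sub_le r hγ0 (hP' k)) hfix (by positivity) hhet' hlam0.le hlam1 hE
    hlamE' hinit hstep T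
  rw [norm_sub_rev]
  refine hmain.trans (add_le_add ?_ ?_)
  · have hz1 : lam * (1 - γ) ≤ 1 := by nlinarith
    have hpow : (1 - lam * (1 - γ)) ^ T ≤ Real.exp (-((1 - γ) * lam * T)) := by
      calc (1 - lam * (1 - γ)) ^ T ≤ Real.exp (-(lam * (1 - γ))) ^ T :=
            pow_le_pow_left₀ (by linarith) (Real.one_sub_le_exp_neg _) T
        _ = _ := by rw [← Real.exp_nat_mul]; ring_nf
    have hexp := exp_neg_le_two_mul_exp_neg_half_sqrt
      (show 0 ≤ (1 - γ) * lam * T by positivity)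
    calc _ ≤ 2 * Real.exp (-(1 / 2) * Real.sqrt ((1 - γ) * lam * T)) * (2 / (1 - γ) ^ 2) :=
          mul_le_mul (hpow.trans hexp) hD (norm_nonneg _) (by positivity)
      _ = _ := by ring
  · have h : 2 * γ * lam * (E - 1) * (γ * (Γ / (1 - γ))) / (1 - γ) =
        2 * γ ^ 2 / (1 - γ) ^ 2 * (lam * ((E : ℝ) - 1)) * Γ := by
      field_simp
    rw [h]
    gcongr
    have : 0 ≤ 6 * lam ^ 2 * ((E : ℝ) - 1) ^ 2 := by positivity
    linarith
end
end

section
/- (Support-function duality for ℓ_p-ball uncertainty sets.) Let S be a nonempty finite set, P ∈ ℝ^S, V ∈ ℝ^S, Γ ≥ 0, and p ∈ [1,∞] with Hölder conjugate p' (1/p + 1/p' = 1). Define 𝒬 = { q ∈ ℝ^S : Σ_s q(s) = 0 and ‖q‖_p ≤ Γ }. Then min_{q ∈ 𝒬} Σ_s (P(s) + q(s)) V(s) = Σ_s P(s) V(s) − Γ · min_{w ∈ ℝ} ‖w·𝟙 − V‖_{p'}, where 𝟙 ∈ ℝ^S is the all-ones vector and ‖·‖_p denotes the ℓ_p norm on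 ℝ^S. -/
open scoped ENNReal

noncomputable section

/-- The ℓ_p norm on `ℝ^S` for `p ∈ [1,∞]` (`p : ℝ≥0∞`). -/
def lpNorm {S : Type*} [Fintype S] [Nonempty S] (p : ℝ≥0∞) (v : S → ℝ) : ℝ :=
  if p = ⊤ then Finset.univ.sup' Finset.univ_nonempty (fun s => |v s|)
  else (∑ s, |v s| ^ p.toReal) ^ (1 / p.toReal)

theorem lpNorm_top {S : Type*} [Fintype S] [Nonempty S] (v : S → ℝ) :
    lpNorm ∞ v = Finset.univ.sup' Finset.univ_nonempty (fun s => |v s|) :=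
  if_pos rfl

theorem lpNorm_one {S : Type*} [Fintype S] [Nonempty S] (v : S → ℝ) :
    lpNorm 1 v = ∑ s, |v s| := by
  simp [lpNorm]

theorem lpNorm_of_ne_top {S : Type*} [Fintype S] [Nonempty S] {p : ℝ≥0∞} (hp : p ≠ ∞)
    (v : S → ℝ) : lpNorm p v = (∑ s, |v s| ^ p.toReal) ^ (1 / p.toReal) :=
  if_neg hp

theorem lpNorm_eq_norm_toLp {S : Type*} [Fintype S] [Nonempty S] {p : ℝ≥0∞} (hp : 1 ≤ p)
    (v : S → ℝ) : lpNorm p v = ‖WithLp.toLp p v‖ := by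
  rcases eq_or_ne p ∞ with rfl | htop
  · rw [lpNorm_top, PiLp.norm_eq_ciSup, Finset.sup'_univ_eq_ciSup]
    rfl
  · rw [lpNorm_of_ne_top htop, PiLp.norm_eq_sum (ENNReal.toReal_pos (by positivity) htop)]
    rfl

theorem lpNorm_const_mul {S : Type*} [Fintype S] [Nonempty S] {p : ℝ≥0∞} (hp : 1 ≤ p)
    (c : ℝ) (v : S → ℝ) : lpNorm p (fun s => c * v s) = |c| * lpNorm p v := by
  have : Fact (1 ≤ p) := ⟨hp⟩
  rw [lpNorm_eq_norm_toLp hp, lpNorm_eq_norm_toLp hp, ← Real.norm_eq_abs, ← norm_smul]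
  rfl

theorem lpNorm_nonneg {S : Type*} [Fintype S] [Nonempty S] {p : ℝ≥0∞} (hp : 1 ≤ p)
    (v : S → ℝ) : 0 ≤ lpNorm p v := by
  have : Fact (1 ≤ p) := ⟨hp⟩
  rw [lpNorm_eq_norm_toLp hp]
  exact norm_nonneg _

theorem sum_mul_le_lpNorm_one_mul_lpNorm_top {S : Type*} [Fintype S] [Nonempty S]
    (u v : S → ℝ) : ∑ s, u s * v s ≤ lpNorm 1 u * lpNorm ∞ v := by
  rw [lpNorm_one, lpNorm_top, Finset.sum_mul]
  refine Finset.sum_le_sum fun s _ => (le_abs_self _).trans ?_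
  rw [abs_mul]
  gcongr
  exact Finset.le_sup' (fun s => |v s|) (Finset.mem_univ s)

/-- Hölder's inequality, including the endpoint exponents. -/
theorem sum_mul_le_lpNorm_mul_lpNorm {S : Type*} [Fintype S] [Nonempty S] {p q : ℝ≥0∞}
    (hpq : p.HolderConjugate q) (u v : S → ℝ) :
    ∑ s, u s * v s ≤ lpNorm p u * lpNorm q v := by
  rcases eq_or_ne p ∞ with rfl | hp
  · obtain rfl : q = 1 := ENNReal.HolderConjugate.unique ∞ q 1
    simpa only [mul_comm] using sum_mul_le_lpNorm_one_mul_lpNorm_top v u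
  rcases eq_or_ne q ∞ with rfl | hq
  · obtain rfl : p = 1 := by
      have := hpq.symm
      exact ENNReal.HolderConjugate.unique ∞ p 1
    exact sum_mul_le_lpNorm_one_mul_lpNorm_top u v
  rw [lpNorm_of_ne_top hp, lpNorm_of_ne_top hq]
  exact Real.inner_le_Lp_mul_Lq _ u v (ENNReal.HolderConjugate.toReal_of_ne_top hp hq)

/-- Equality is attained in Hölder's inequality. -/
theorem exists_lpNorm_le_one_sum_mul_eq {S : Type*} [Fintype S] [Nonempty S] {p q : ℝ≥0∞}
    (hpq : p.HolderConjugate q) (u : S → ℝ) :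
    ∃ v : S → ℝ, lpNorm q v ≤ 1 ∧ ∑ s, u s * v s = lpNorm p u := by
  classical
  have abs_sign_le (x : ℝ) : |(SignType.sign x : ℝ)| ≤ 1 := by
    rcases lt_trichotomy x 0 with h | rfl | h <;> simp [*]
  rcases eq_or_ne p ∞ with rfl | hp
  · obtain rfl : q = 1 := ENNReal.HolderConjugate.unique ∞ q 1
    obtain ⟨t, -, ht⟩ := Finset.exists_mem_eq_sup' Finset.univ_nonempty (fun s => |u s|)
    refine ⟨Pi.single t (SignType.sign (u t) : ℝ), ?_, ?_⟩
    · rw [lpNorm_one, Finset.sum_eq_single t]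
      · simpa using abs_sign_le (u t)
      · intro s _ hs
        simp [hs]
      · simp
    · rw [lpNorm_top, ht, Finset.sum_eq_single t]
      · simp
      · intro s _ hs
        simp [hs]
      · simp
  rcases eq_or_ne q ∞ with rfl | hq
  · obtain rfl : p = 1 := by
      have := hpq.symm
      exact ENNReal.HolderConjugate.unique ∞ p 1
    refine ⟨fun s => (SignType.sign (u s) : ℝ), ?_, ?_⟩
    · rw [lpNorm_top]
      exact Finset.sup'_le _ _ fun s _ => abs_sign_le (u s)
    · simp [lpNorm_one]
  have hpq' := ENNReal.HolderConjugate.toReal_of_ne_top (p := p) (q := q) hp hq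
  obtain ⟨g, hg, hsum⟩ := (NNReal.isGreatest_Lp Finset.univ (fun s => ‖u s‖₊) hpq').1
  refine ⟨fun s => SignType.sign (u s) * g s, ?_, ?_⟩
  · rw [lpNorm_of_ne_top hq]
    refine Real.rpow_le_one (by positivity) ?_ (by positivity)
    have hg' : ∑ s, (g s : ℝ) ^ q.toReal ≤ 1 := by exact_mod_cast hg
    refine le_trans (Finset.sum_le_sum fun s _ => ?_) hg'
    gcongr
    rw [abs_mul, NNReal.abs_eq]
    exact mul_le_of_le_one_left (by positivity) (abs_sign_le _)
  · rw [lpNorm_of_ne_top hp]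
    have h := congrArg ((↑) : NNReal → ℝ) hsum
    push_cast [Real.norm_eq_abs] at h
    simpa [← mul_assoc] using h

/-- The distance in `ℓ_q` from `V` to the constant vectors is realised by a zero-sum vector in the
unit ball of the dual norm. -/
theorem exists_sum_eq_zero_sum_mul_eq_iInf {S : Type*} [Fintype S] [Nonempty S] {p q : ℝ≥0∞}
    (hpq : p.HolderConjugate q) (V : S → ℝ) :
    ∃ u : S → ℝ, ∑ s, u s = 0 ∧ lpNorm p u ≤ 1 ∧
      ∑ s, u s * V s = ⨅ w : ℝ, lpNorm q (fun s => w - V s) := by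
  classical
  have hq : 1 ≤ q := by
    have := hpq.symm
    exact ENNReal.HolderConjugate.one_le q p
  have : Fact (1 ≤ q) := ⟨hq⟩
  let C : Submodule ℝ (PiLp q fun _ : S => ℝ) := Submodule.span ℝ {WithLp.toLp q 1}
  obtain ⟨g, hg, hgV⟩ := exists_dual_vector'' ℝ (C.mkQ (WithLp.toLp q V))
  let f : (S → ℝ) →ₗ[ℝ] ℝ :=
    g.toLinearMap ∘ₗ C.mkQ ∘ₗ (WithLp.linearEquiv q ℝ (S → ℝ)).symm.toLinearMap
  have hf_apply (v : S → ℝ) : f v = g (C.mkQ (WithLp.toLp q v)) := rfl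
  have hf (v : S → ℝ) : ∑ s, f (Pi.single s 1) * v s = f v := by
    rw [LinearMap.pi_apply_eq_sum_univ f v]
    refine Finset.sum_congr rfl fun s _ => ?_
    rw [smul_eq_mul, mul_comm]
    congr 2
    ext t
    simp [Pi.single_apply, eq_comm]
  have hf_le (v : S → ℝ) : f v ≤ lpNorm q v := by
    rw [lpNorm_eq_norm_toLp hq, hf_apply]
    exact (le_abs_self _).trans <| (g.le_of_opNorm_le hg _).trans <| by
      simpa using Submodule.Quotient.norm_mk_le C (WithLp.toLp q v)
  refine ⟨fun s => f (Pi.single s 1), ?_, ?_, ?_⟩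
  · have h := hf 1
    have h1 : C.mkQ (WithLp.toLp q 1) = 0 :=
      (Submodule.Quotient.mk_eq_zero C).2 (Submodule.mem_span_singleton_self _)
    rw [hf_apply, h1, map_zero] at h
    simpa using h
  · obtain ⟨v, hv, hsum⟩ := exists_lpNorm_le_one_sum_mul_eq hpq fun s => f (Pi.single s 1)
    rw [← hsum, hf]
    exact (hf_le v).trans hv
  · rw [hf, hf_apply, hgV]
    have hdist : ‖C.mkQ (WithLp.toLp q V)‖ = Metric.infDist (WithLp.toLp q V) C :=
      QuotientAddGroup.norm_mk (S := C.toAddSubgroup) _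
    have hline : (C : Set (PiLp q fun _ : S => ℝ)) =
        Set.range fun w : ℝ => w • WithLp.toLp q (1 : S → ℝ) := by
      ext x
      simp [C, Submodule.mem_span_singleton]
    rw [RCLike.ofReal_real_eq_id, id, hdist, Metric.infDist_eq_iInf, hline,
      iInf_range' (g := fun y => dist (WithLp.toLp q V) y)]
    refine iInf_congr fun w => ?_
    rw [lpNorm_eq_norm_toLp hq, dist_comm, dist_eq_norm]
    congr 1
    ext s
    simp

/-- **Support-function duality for ℓ_p-ball uncertainty sets.**
For `𝒬 = {q : Σ_s q s = 0, ‖q‖_p ≤ Γ}` and Hölder conjugates `p, p'`,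
`min_{q ∈ 𝒬} Σ_s (P s + q s) V s = Σ_s P s V s − Γ · min_w ‖w·𝟙 − V‖_{p'}`. -/
theorem lp_ball_support_duality {S : Type*} [Fintype S] [Nonempty S]
    (P V : S → ℝ) (Γ : ℝ) (hΓ : 0 ≤ Γ)
    (p p' : ℝ≥0∞) (hp : 1 ≤ p) (hpq : 1 / p + 1 / p' = 1) :
    sInf ((fun q => ∑ s, (P s + q s) * V s) ''
        {q : S → ℝ | (∑ s, q s = 0) ∧ lpNorm p q ≤ Γ})
      = (∑ s, P s * V s)
        - Γ * sInf (Set.range fun w : ℝ => lpNorm p' (fun s => w - V s)) := by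
  have hconj : p.HolderConjugate p' := by
    rw [ENNReal.holderConjugate_iff]
    simpa using hpq
  have hp' : 1 ≤ p' := by
    have := hconj.symm
    exact ENNReal.HolderConjugate.one_le p' p
  rw [sInf_range]
  refine IsLeast.csInf_eq ⟨?_, ?_⟩
  · obtain ⟨u, hu₀, hu₁, huV⟩ := exists_sum_eq_zero_sum_mul_eq_iInf hconj V
    refine ⟨fun s => -Γ * u s, ⟨?_, ?_⟩, ?_⟩
    · rw [← Finset.mul_sum, hu₀, mul_zero]
    · rw [lpNorm_const_mul hp, abs_neg, abs_of_nonneg hΓ]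
      exact mul_le_of_le_one_right hΓ hu₁
    · simp only [add_mul, Finset.sum_add_distrib, mul_assoc, ← Finset.mul_sum, huV]
      ring
  · rintro _ ⟨u, ⟨hu₀, hu⟩, rfl⟩
    have key : -∑ s, u s * V s ≤ Γ * ⨅ w : ℝ, lpNorm p' (fun s => w - V s) := by
      rw [Real.mul_iInf_of_nonneg hΓ]
      refine le_ciInf fun w => ?_
      calc -∑ s, u s * V s = ∑ s, u s * (w - V s) := by
            simp [mul_sub, Finset.sum_sub_distrib, ← Finset.sum_mul, hu₀]
        _ ≤ lpNorm p u * lpNorm p' (fun s => w - V s) := sum_mul_le_lpNorm_mul_lpNorm hconj _ _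
        _ ≤ Γ * lpNorm p' (fun s => w - V s) :=
            mul_le_mul_of_nonneg_right hu (lpNorm_nonneg hp' _)
    simp only [add_mul, Finset.sum_add_distrib]
    linarith
end
end

section
/- (Convergence of MDTL-Max with exact operators.) Assume λ ≤ 1/E, 4γλ(E−1) ≤ 1−γ, (1−γ)T ≥ 2λE², and that the heterogeneity bound |σ_{(𝒫_k)_s^a}(V_MP) − max_{j∈{1,…,K}} σ_{(𝒫_j)_s^a}(V_MP)| ≤ Γ/(1−γ) holds for all k, s, a, where V_MP(s) = max_a Q_MP(s,a). Then the MDTL-Max iterates satisfy ‖Q_MP − max_{k} Q_k^T‖ ≤ (4/(1−γ)²)·exp(−(1/2)·√((1−γ)λT)) + (2γ²/(1−γ)²)·(6λ²(E−1)² + λ(E−1))·Γ, where max_k Q_k^T is the entrywise maximum. -/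
noncomputable section

theorem suppFn_zero {S : Type*} [Fintype S] {C : Set (S → ℝ)} (hne : C.Nonempty) :
    suppFn C (fun _ => 0) = 0 := by
  simp [suppFn, hne.image_const]

section Bellman

variable {S A : Type*} [Fintype S] [Fintype A] [Nonempty A] {r : S × A → ℝ} {γ : ℝ}

theorem optRobustOp_le_add {P : S → A → Set (S → ℝ)} (hγ0 : 0 ≤ γ)
    (hP : ∀ s a, (P s a).Nonempty ∧ P s a ⊆ simplex S) {Q Q' : S × A → ℝ} {c : ℝ}
    (h : ∀ sa, Q sa ≤ Q' sa + c) (sa : S × A) :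
    optRobustOp r γ P Q sa ≤ optRobustOp r γ P Q' sa + γ * c := by
  have key := suppFn_le_suppFn_add (hP sa.1 sa.2).1 (hP sa.1 sa.2).2
    (v := fun s' => Finset.univ.sup' Finset.univ_nonempty (fun a' => Q (s', a')))
    (w := fun s' => Finset.univ.sup' Finset.univ_nonempty (fun a' => Q' (s', a'))) (c := c)
    (fun s => Finset.sup'_le _ _ fun a _ => (h (s, a)).trans
      (add_le_add_left (Finset.le_sup' (fun a' => Q' (s, a')) (Finset.mem_univ a)) c))
  unfold optRobustOp
  linarith [mul_le_mul_of_nonneg_left key hγ0]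

theorem optRobustOp_zero {P : S → A → Set (S → ℝ)} (hP : ∀ s a, (P s a).Nonempty) (sa : S × A) :
    optRobustOp r γ P (fun _ => 0) sa = r sa := by
  simp [optRobustOp, suppFn_zero (hP sa.1 sa.2)]

variable {K : ℕ} [NeZero K] {P : Fin K → S → A → Set (S → ℝ)} {QMP : S × A → ℝ}

theorem optRobustOp_le_of_fixedPoint
    (hQMP : (fun sa => Finset.univ.sup' Finset.univ_nonempty
      (fun k => optRobustOp r γ (P k) QMP sa)) = QMP) (k : Fin K) (sa : S × A) :
    optRobustOp r γ (P k) QMP sa ≤ QMP sa :=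
  (Finset.le_sup' (fun k => optRobustOp r γ (P k) QMP sa) (Finset.mem_univ k)).trans_eq
    (congrFun hQMP sa)

theorem exists_optRobustOp_eq_of_fixedPoint
    (hQMP : (fun sa => Finset.univ.sup' Finset.univ_nonempty
      (fun k => optRobustOp r γ (P k) QMP sa)) = QMP) (sa : S × A) :
    ∃ k, optRobustOp r γ (P k) QMP sa = QMP sa := by
  obtain ⟨k, -, hk⟩ := Finset.exists_mem_eq_sup' Finset.univ_nonempty
    (fun k => optRobustOp r γ (P k) QMP sa)
  exact ⟨k, hk.symm.trans (congrFun hQMP sa)⟩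

theorem fixedPoint_nonneg [Nonempty S] (hr : ∀ sa, 0 ≤ r sa) (hγ0 : 0 ≤ γ) (hγ1 : γ < 1)
    (hP : ∀ k s a, (P k s a).Nonempty ∧ P k s a ⊆ simplex S)
    (hQMP : (fun sa => Finset.univ.sup' Finset.univ_nonempty
      (fun k => optRobustOp r γ (P k) QMP sa)) = QMP) (sa : S × A) : 0 ≤ QMP sa := by
  obtain ⟨m, hm⟩ := Finite.exists_min QMP
  have h1 := optRobustOp_le_add (r := r) hγ0 (hP 0) (Q := fun _ => 0) (Q' := QMP) (c := -QMP m)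
    (fun x => by linarith [hm x]) m
  rw [optRobustOp_zero (fun s a => (hP 0 s a).1)] at h1
  have h2 := optRobustOp_le_of_fixedPoint hQMP 0 m
  nlinarith [hr m, hm sa]

theorem fixedPoint_le [Nonempty S] (hr : ∀ sa, r sa ≤ 1) (hγ0 : 0 ≤ γ) (hγ1 : γ < 1)
    (hP : ∀ k s a, (P k s a).Nonempty ∧ P k s a ⊆ simplex S)
    (hQMP : (fun sa => Finset.univ.sup' Finset.univ_nonempty
      (fun k => optRobustOp r γ (P k) QMP sa)) = QMP) (sa : S × A) :
    QMP sa ≤ 1 / (1 - γ) := by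
  obtain ⟨m, hm⟩ := Finite.exists_max QMP
  obtain ⟨k, hk⟩ := exists_optRobustOp_eq_of_fixedPoint hQMP m
  have h1 := optRobustOp_le_add (r := r) hγ0 (hP k) (Q := QMP) (Q' := fun _ => 0) (c := QMP m)
    (fun x => by linarith [hm x]) m
  rw [optRobustOp_zero (fun s a => (hP k s a).1)] at h1
  rw [le_div_iff₀ (by linarith)]
  nlinarith [hr m, hm sa]

/-- The heterogeneity bound controls how far each `T_k` moves the fixed point. -/
theorem fixedPoint_sub_le_optRobustOp (hγ0 : 0 ≤ γ) {δ : ℝ}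
    (hQMP : (fun sa => Finset.univ.sup' Finset.univ_nonempty
      (fun k => optRobustOp r γ (P k) QMP sa)) = QMP)
    (hhet : ∀ k s a,
      |suppFn (P k s a)
          (fun s' => Finset.univ.sup' Finset.univ_nonempty (fun a' => QMP (s', a')))
        - Finset.univ.sup' Finset.univ_nonempty (fun j => suppFn (P j s a)
          (fun s' => Finset.univ.sup' Finset.univ_nonempty (fun a' => QMP (s', a'))))| ≤ δ)
    (k : Fin K) (sa : S × A) :
    QMP sa - γ * δ ≤ optRobustOp r γ (P k) QMP sa := by
  obtain ⟨j, hj⟩ := exists_optRobustOp_eq_of_fixedPoint hQMP sa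
  have h1 := (abs_le.1 (hhet k sa.1 sa.2)).1
  have h2 := Finset.le_sup' (fun j => suppFn (P j sa.1 sa.2)
    (fun s' => Finset.univ.sup' Finset.univ_nonempty (fun a' => QMP (s', a')))) (Finset.mem_univ j)
  rw [← hj]
  unfold optRobustOp
  have h3 := mul_le_mul_of_nonneg_left (h2.trans (sub_nonneg.1 (by linarith) :
    _ ≤ suppFn (P k sa.1 sa.2) (fun s' => Finset.univ.sup' Finset.univ_nonempty
      (fun a' => QMP (s', a'))) + δ)) hγ0
  linarith

/-- The iterates exceed the fixed point by at most a contracting term, and fall below it by at most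
this term, a bias `B` and the drift since the last aggregation; the agent
attaining the maximum at an entry does not suffer from this drift there. -/
theorem iterate_bounds (hγ0 : 0 ≤ γ)
    (hP : ∀ k s a, (P k s a).Nonempty ∧ P k s a ⊆ simplex S)
    (hQMP : (fun sa => Finset.univ.sup' Finset.univ_nonempty
      (fun k => optRobustOp r γ (P k) QMP sa)) = QMP)
    {lam : ℝ} (hlam0 : 0 ≤ lam) (hlam1 : lam ≤ 1) {E : ℕ} (hE : 1 ≤ E) {g B D : ℝ} (hg : 0 ≤ g)
    (hB : 0 ≤ B) (hγ1 : γ ≤ 1) (hgB : lam * γ * ((E : ℝ) - 1) * g ≤ (1 - γ) * B)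
    (hdrift : ∀ k sa, QMP sa - g ≤ optRobustOp r γ (P k) QMP sa)
    {Qk : ℕ → Fin K → (S × A → ℝ)}
    (hinit : ∀ k sa, |Qk 0 k sa - QMP sa| ≤ D)
    (hstep : ∀ t k, Qk (t + 1) k =
      if (t + 1) % E = 0 then
        (fun sa => Finset.univ.sup' Finset.univ_nonempty
          (fun j => ((1 - lam) • Qk t j + lam • optRobustOp r γ (P j) (Qk t j)) sa))
      else (1 - lam) • Qk t k + lam • optRobustOp r γ (P k) (Qk t k)) (t : ℕ) :
    (∀ k sa, Qk t k sa ≤ QMP sa + (1 - lam * (1 - γ)) ^ t * D) ∧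
    (∀ k sa, QMP sa ≤ Qk t k sa +
      ((1 - lam * (1 - γ)) ^ t * D + B + lam * ((t % E : ℕ) : ℝ) * g)) ∧
    (∀ k sa, optRobustOp r γ (P k) QMP sa = QMP sa →
      QMP sa ≤ Qk t k sa + ((1 - lam * (1 - γ)) ^ t * D + B)) := by
  induction t with
  | zero =>
    simp only [pow_zero, one_mul, Nat.zero_mod, Nat.cast_zero, mul_zero, zero_mul, add_zero]
    have h := fun k sa => abs_le.1 (hinit k sa)
    exact ⟨fun k sa => by linarith [(h k sa).2], fun k sa => by linarith [(h k sa).1],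
      fun k sa _ => by linarith [(h k sa).1]⟩
  | succ t ih =>
    obtain ⟨hup, hlow, hbest⟩ := ih
    set β := 1 - lam * (1 - γ) with hβ
    set x := β ^ t * D with hx
    have hx' : β ^ (t + 1) * D = β * x := by rw [hx, pow_succ]; ring
    rw [hx']
    set n : ℝ := ((t % E : ℕ) : ℝ) with hn
    have hn0 : 0 ≤ n := Nat.cast_nonneg _
    have hnE : n ≤ (E : ℝ) - 1 := by
      have : t % E + 1 ≤ E := Nat.mod_lt _ hE
      have : ((t % E + 1 : ℕ) : ℝ) ≤ E := Nat.cast_le.2 this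
      push_cast at this
      linarith
    have hlam1' : 0 ≤ 1 - lam := by linarith
    have hloc : ∀ k sa, ((1 - lam) • Qk t k + lam • optRobustOp r γ (P k) (Qk t k)) sa =
        (1 - lam) * Qk t k sa + lam * optRobustOp r γ (P k) (Qk t k) sa := fun k sa => by simp
    have hRup : ∀ k sa, ((1 - lam) • Qk t k + lam • optRobustOp r γ (P k) (Qk t k)) sa ≤
        QMP sa + β * x := by
      intro k sa
      rw [hloc]
      have h1 := mul_le_mul_of_nonneg_left (hup k sa) hlam1'
      have h2 := mul_le_mul_of_nonneg_left ((optRobustOp_le_add (r := r) hγ0 (hP k) (hup k) sa).trans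
        (add_le_add_left (optRobustOp_le_of_fixedPoint hQMP k sa) _)) hlam0
      linear_combination h1 + h2
    have hRlow : ∀ k sa, QMP sa ≤
        ((1 - lam) • Qk t k + lam • optRobustOp r γ (P k) (Qk t k)) sa +
          (β * x + B + lam * (n + 1) * g) := by
      intro k sa
      rw [hloc]
      have h1 := mul_le_mul_of_nonneg_left (hlow k sa) hlam1'
      have h2 := mul_le_mul_of_nonneg_left (optRobustOp_le_add (r := r) hγ0 (hP k) (hlow k) sa) hlam0
      have h3 := mul_le_mul_of_nonneg_left (hdrift k sa) hlam0
      have h4 : 0 ≤ lam * (1 - γ) * (B + lam * n * g) :=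
        mul_nonneg (mul_nonneg hlam0 (by linarith)) (by positivity)
      linear_combination h1 + h2 + h3 + h4
    have hRbest : ∀ k sa, optRobustOp r γ (P k) QMP sa = QMP sa → QMP sa ≤
        ((1 - lam) • Qk t k + lam • optRobustOp r γ (P k) (Qk t k)) sa + (β * x + B) := by
      intro k sa hk
      rw [hloc]
      have h1 := mul_le_mul_of_nonneg_left (hbest k sa hk) hlam1'
      have h2 := mul_le_mul_of_nonneg_left (optRobustOp_le_add (r := r) hγ0 (hP k) (hlow k) sa) hlam0
      rw [hk] at h2
      have h3 : lam * γ * n * g ≤ (1 - γ) * B := le_trans (by gcongr) hgB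
      have h4 := mul_le_mul_of_nonneg_left h3 hlam0
      linear_combination h1 + h2 + h4
    by_cases hs : (t + 1) % E = 0
    · have hge : ∀ k sa, QMP sa ≤ Qk (t + 1) k sa + (β * x + B) := by
        intro k sa
        obtain ⟨j, hj⟩ := exists_optRobustOp_eq_of_fixedPoint hQMP sa
        rw [hstep, if_pos hs]
        exact (hRbest j sa hj).trans (add_le_add_left (Finset.le_sup' (fun j =>
          ((1 - lam) • Qk t j + lam • optRobustOp r γ (P j) (Qk t j)) sa) (Finset.mem_univ j)) _)
      refine ⟨fun k sa => ?_, fun k sa => ?_, fun k sa _ => hge k sa⟩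
      · rw [hstep, if_pos hs]
        exact Finset.sup'_le _ _ fun j _ => hRup j sa
      · simpa [hs] using hge k sa
    · have hmod : (((t + 1) % E : ℕ) : ℝ) = n + 1 := by
        rw [hn, ← Nat.cast_succ, Nat.cast_inj, Nat.succ_eq_add_one]
        have h1 : t % E + 1 ≤ E := Nat.mod_lt _ hE
        have h2 : (t + 1) % E = (t % E + 1) % E := by simp
        rcases h1.lt_or_eq with h | h
        · rw [h2, Nat.mod_eq_of_lt h]
        · rw [h2, h, Nat.mod_self] at hs
          exact absurd rfl hs
      rw [hmod]
      simp only [hstep t, if_neg hs]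
      exact ⟨hRup, hRlow, hRbest⟩

end Bellman

theorem exp_neg_le_four_mul_exp_sqrt {y : ℝ} (hy : 0 ≤ y) :
    Real.exp (-y) ≤ 4 * Real.exp (-(1 / 2) * Real.sqrt y) := by
  have h1 : -y ≤ 1 + -(1 / 2) * Real.sqrt y := by
    nlinarith [Real.sq_sqrt hy, sq_nonneg (Real.sqrt y - 1 / 4)]
  calc Real.exp (-y) ≤ Real.exp (1 + -(1 / 2) * Real.sqrt y) := Real.exp_le_exp.2 h1
    _ = Real.exp 1 * Real.exp (-(1 / 2) * Real.sqrt y) := Real.exp_add _ _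
    _ ≤ _ := by
      gcongr
      linarith [Real.exp_one_lt_d9]

/-- **Convergence of MDTL-Max with exact operators.**  Under step-size and
synchronization-period conditions, the entrywise maximum of the MDTL-Max
iterates converges to the fixed point `QMP` of the optimal minimal-pessimism
operator at the stated rate. -/
theorem mdtl_max_convergence {S A : Type*} [Fintype S] [Fintype A]
    [Nonempty S] [Nonempty A]
    (r : S × A → ℝ) (hr : ∀ sa, 0 ≤ r sa ∧ r sa ≤ 1)
    (γ : ℝ) (hγ0 : 0 ≤ γ) (hγ1 : γ < 1)
    (K : ℕ) [NeZero K]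
    (P : Fin K → S → A → Set (S → ℝ))
    (hP : ∀ k s a, (P k s a).Nonempty ∧ IsCompact (P k s a) ∧ P k s a ⊆ simplex S)
    (QMP : S × A → ℝ)
    (hQMP : (fun sa => Finset.univ.sup' Finset.univ_nonempty
      (fun k => optRobustOp r γ (P k) QMP sa)) = QMP)
    (lam : ℝ) (hlam0 : 0 < lam) (hlam1 : lam ≤ 1)
    (E T : ℕ) (hE : 1 ≤ E)
    (hlamE : lam ≤ 1 / (E : ℝ))
    (hEγ : 4 * γ * lam * ((E : ℝ) - 1) ≤ 1 - γ)
    (hT : 2 * lam * (E : ℝ) ^ 2 ≤ (1 - γ) * (T : ℝ))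
    (Γ : ℝ) (hΓ0 : 0 ≤ Γ)
    (hhet : ∀ k s a,
      |suppFn (P k s a)
          (fun s' => Finset.univ.sup' Finset.univ_nonempty (fun a' => QMP (s', a')))
        - Finset.univ.sup' Finset.univ_nonempty (fun j => suppFn (P j s a)
          (fun s' => Finset.univ.sup' Finset.univ_nonempty (fun a' => QMP (s', a'))))|
        ≤ Γ / (1 - γ))
    (Q0 : S × A → ℝ) (hQ0 : ∀ sa, 0 ≤ Q0 sa ∧ Q0 sa ≤ 1 / (1 - γ))
    (Qk : ℕ → Fin K → (S × A → ℝ))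
    (hinit : ∀ k, Qk 0 k = Q0)
    (hstep : ∀ t k, Qk (t + 1) k =
      if (t + 1) % E = 0 then
        (fun sa => Finset.univ.sup' Finset.univ_nonempty
          (fun j => ((1 - lam) • Qk t j + lam • optRobustOp r γ (P j) (Qk t j)) sa))
      else (1 - lam) • Qk t k + lam • optRobustOp r γ (P k) (Qk t k)) :
    ‖QMP - fun sa => Finset.univ.sup' Finset.univ_nonempty (fun k => Qk T k sa)‖ ≤
      4 / (1 - γ) ^ 2 * Real.exp (-(1 / 2) * Real.sqrt ((1 - γ) * lam * T))
        + 2 * γ ^ 2 / (1 - γ) ^ 2 * (6 * lam ^ 2 * ((E : ℝ) - 1) ^ 2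
            + lam * ((E : ℝ) - 1)) * Γ := by
  have hγ : 0 < 1 - γ := by linarith
  have hE' : 0 ≤ (E : ℝ) - 1 := sub_nonneg.2 (by exact_mod_cast hE)
  have hP' : ∀ k s a, (P k s a).Nonempty ∧ P k s a ⊆ simplex S :=
    fun k s a => ⟨(hP k s a).1, (hP k s a).2.2⟩
  set g := γ * (Γ / (1 - γ)) with hg
  set B := lam * γ * ((E : ℝ) - 1) * g / (1 - γ) with hB
  have hg0 : 0 ≤ g := by positivity
  have hB0 : 0 ≤ B := by positivity
  obtain ⟨hup, -, hbest⟩ := iterate_bounds hγ0 hP' hQMP hlam0.le hlam1 hE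
    (D := 1 / (1 - γ)) hg0 hB0 hγ1.le (by rw [hB, mul_div_cancel₀ _ hγ.ne'])
    (fixedPoint_sub_le_optRobustOp hγ0 hQMP hhet)
    (fun k sa => by
      rw [hinit, abs_le]
      have h1 := fixedPoint_nonneg (fun sa => (hr sa).1) hγ0 hγ1 hP' hQMP sa
      have h2 := fixedPoint_le (fun sa => (hr sa).2) hγ0 hγ1 hP' hQMP sa
      have h3 := hQ0 sa
      constructor <;> linarith) hstep T
  set y := (1 - γ) * lam * T with hy
  have hy0 : 0 ≤ y := by positivity
  have hpow : (1 - lam * (1 - γ)) ^ T * (1 / (1 - γ)) ≤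
      4 / (1 - γ) ^ 2 * Real.exp (-(1 / 2) * Real.sqrt y) := by
    have h1 : (1 - lam * (1 - γ)) ^ T ≤ Real.exp (-y) := by
      have h0 : 0 ≤ 1 - lam * (1 - γ) := by nlinarith
      calc (1 - lam * (1 - γ)) ^ T ≤ Real.exp (-(lam * (1 - γ))) ^ T :=
            pow_le_pow_left₀ h0 (Real.one_sub_le_exp_neg _) T
        _ = Real.exp (-y) := by rw [← Real.exp_nat_mul, hy]; ring_nf
    have h2 : 1 / (1 - γ) ≤ 1 / (1 - γ) ^ 2 :=
      one_div_le_one_div_of_le (by positivity) (by nlinarith)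
    calc (1 - lam * (1 - γ)) ^ T * (1 / (1 - γ))
        ≤ (4 * Real.exp (-(1 / 2) * Real.sqrt y)) * (1 / (1 - γ) ^ 2) :=
          mul_le_mul (h1.trans (exp_neg_le_four_mul_exp_sqrt hy0)) h2 (by positivity)
            (by positivity)
      _ = _ := by ring
  have hbias : B ≤ 2 * γ ^ 2 / (1 - γ) ^ 2 * (6 * lam ^ 2 * ((E : ℝ) - 1) ^ 2
      + lam * ((E : ℝ) - 1)) * Γ := by
    have h1 : B = γ ^ 2 / (1 - γ) ^ 2 * (lam * ((E : ℝ) - 1)) * Γ := by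
      rw [hB, hg]
      field_simp
    have h2 : 0 ≤ γ ^ 2 / (1 - γ) ^ 2 * (12 * lam ^ 2 * ((E : ℝ) - 1) ^ 2
        + lam * ((E : ℝ) - 1)) * Γ := by positivity
    rw [h1]
    linear_combination h2
  refine (pi_norm_le_iff_of_nonneg (by positivity)).2 fun sa => ?_
  rw [Pi.sub_apply, Real.norm_eq_abs, abs_le]
  constructor
  · have h := Finset.sup'_le Finset.univ_nonempty (fun k => Qk T k sa) fun k _ => hup k sa
    linarith
  · obtain ⟨k, hk⟩ := exists_optRobustOp_eq_of_fixedPoint hQMP sa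
    have h1 := hbest k sa hk
    have h2 := Finset.le_sup' (fun k => Qk T k sa) (Finset.mem_univ k)
    linarith
end
end
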